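/- (Necessity direction of Theorem 1.) Let (μₙ) be a sequence of Borel probability measures on ℝ and let a < b be real numbers. Suppose that for each n the moment generating function Mₙ(t) = ∫ℝ e^{tx} dμₙ(x) is finite for every t ∈ (a,b), and that Mₙ(t) converges, for every t ∈ (a,b), to M(t), where M is the moment generating function of a Borel probability measure μ and M(t) is finite for every t ∈ (a,b). Then for every t ∈ (a,b) one has sup over n of Mₙ(t) < ∞, and (μₙ) converges weakly to μ. -/

import Mathlib

open MeasureTheory Filter Set BoundedContinuousFunction

open ProbabilityTheory Topology

/-- Two probability measures on `ℝ` with equal moment generating functions near `0` coincide. -/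
theorem MeasureTheory.Measure.ext_of_eqOn_mgf {ρ ρ' : Measure ℝ} [IsProbabilityMeasure ρ]
    [IsProbabilityMeasure ρ'] {δ : ℝ} (hδ : 0 < δ)
    (hρ : ∀ t ∈ Ioo (-δ) δ, Integrable (fun x => Real.exp (t * x)) ρ)
    (hρ' : ∀ t ∈ Ioo (-δ) δ, Integrable (fun x => Real.exp (t * x)) ρ')
    (h : ∀ t ∈ Ioo (-δ) δ, ∫ x, Real.exp (t * x) ∂ρ = ∫ x, Real.exp (t * x) ∂ρ') :
    ρ = ρ' := by
  have hsub (κ : Measure ℝ) (hκ : ∀ t ∈ Ioo (-δ) δ, Integrable (fun x => Real.exp (t * x)) κ) :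
      AnalyticOnNhd ℂ (complexMGF id κ) {z | z.re ∈ Ioo (-δ) δ} :=
    analyticOnNhd_complexMGF.mono fun z hz => interior_maximal hκ isOpen_Ioo hz
  have hfreq : ∃ᶠ x : ℝ in 𝓝[≠] 0, complexMGF id ρ x = complexMGF id ρ' x := by
    refine Eventually.frequently (eventually_nhdsWithin_of_eventually_nhds ?_)
    filter_upwards [Ioo_mem_nhds (neg_lt_zero.mpr hδ) hδ] with t ht
    rw [complexMGF_ofReal, complexMGF_ofReal]
    exact congrArg _ (h t ht)
  have htend : Tendsto (fun x : ℝ => (x : ℂ)) (𝓝[≠] 0) (𝓝[≠] ((0 : ℝ) : ℂ)) :=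
    tendsto_nhdsWithin_of_tendsto_nhds_of_eventually_within _
      (Complex.continuous_ofReal.continuousAt.tendsto.mono_left nhdsWithin_le_nhds)
      (eventually_nhdsWithin_of_forall fun x hx => by simpa using hx)
  have hEq : EqOn (complexMGF id ρ) (complexMGF id ρ') {z | z.re ∈ Ioo (-δ) δ} :=
    (hsub ρ hρ).eqOn_of_preconnected_of_frequently_eq (hsub ρ' hρ')
      ((convex_Ioo (-δ) δ).linear_preimage Complex.reLm).isPreconnected
      (z₀ := ((0 : ℝ) : ℂ)) (by simpa using hδ) (htend.frequently hfreq)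
  refine Measure.ext_of_charFun (funext fun t => ?_)
  rw [← complexMGF_id_mul_I, ← complexMGF_id_mul_I]
  exact hEq (by simpa using hδ)

/-- Measures on `ℝ` whose exponential moments at `δ` and `-δ` are bounded form a tight set. -/
theorem isTightMeasureSet_range_of_integral_exp_le {ι : Type*} {ρ : ι → Measure ℝ}
    [∀ i, IsFiniteMeasure (ρ i)] {δ C : ℝ} (hδ : 0 < δ)
    (hpos : ∀ i, Integrable (fun x => Real.exp (δ * x)) (ρ i))
    (hneg : ∀ i, Integrable (fun x => Real.exp (-δ * x)) (ρ i))
    (hposC : ∀ i, ∫ x, Real.exp (δ * x) ∂(ρ i) ≤ C)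
    (hnegC : ∀ i, ∫ x, Real.exp (-δ * x) ∂(ρ i) ≤ C) :
    IsTightMeasureSet (range ρ) := by
  refine isTightMeasureSet_of_tendsto_measure_norm_gt ?_
  have hbound (r : ℝ) (i : ι) :
      ρ i {x | r < ‖x‖} ≤ ENNReal.ofReal (Real.exp (-δ * r) * (C + C)) := by
    have hsub : {x : ℝ | r < ‖x‖} ⊆ {x | r ≤ id x} ∪ {x | id x ≤ -r} := by
      intro x hx
      rcases lt_abs.mp (Real.norm_eq_abs x ▸ hx : r < |x|) with h | h
      · exact Or.inl h.le
      · exact Or.inr (show x ≤ -r by linarith)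
    rw [← ofReal_measureReal]
    refine ENNReal.ofReal_le_ofReal ?_
    calc (ρ i).real {x | r < ‖x‖}
        ≤ (ρ i).real {x | r ≤ id x} + (ρ i).real {x | id x ≤ -r} :=
          (measureReal_mono hsub).trans (measureReal_union_le _ _)
      _ ≤ Real.exp (-δ * r) * mgf id (ρ i) δ + Real.exp (-(-δ) * -r) * mgf id (ρ i) (-δ) :=
          add_le_add (measure_ge_le_exp_mul_mgf r hδ.le (hpos i))
            (measure_le_le_exp_mul_mgf (-r) (neg_nonpos.mpr hδ.le) (hneg i))
      _ ≤ Real.exp (-δ * r) * C + Real.exp (-(-δ) * -r) * C := by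
          gcongr
          · exact hposC i
          · exact hnegC i
      _ = Real.exp (-δ * r) * (C + C) := by ring_nf
  have hlim : Tendsto (fun r : ℝ => ENNReal.ofReal (Real.exp (-δ * r) * (C + C))) atTop (𝓝 0) := by
    have h : Tendsto (fun r : ℝ => Real.exp (-δ * r) * (C + C)) atTop (𝓝 (0 * (C + C))) :=
      (Real.tendsto_exp_atBot.comp
        (tendsto_id.const_mul_atTop_of_neg (neg_lt_zero.mpr hδ))).mul_const _
    simpa using ENNReal.tendsto_ofReal h
  refine tendsto_of_tendsto_of_tendsto_of_le_of_le tendsto_const_nhds hlim (fun _ => zero_le) ?_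
  intro r
  simpa only [iSup_range, iSup_le_iff] using hbound r

section Truncation

variable {X : Type*} [TopologicalSpace X]

/-- The truncation `x ↦ min (g x) K` of a nonnegative continuous function. -/
noncomputable def truncate (g : X → ℝ) (hg : Continuous g) (hg0 : ∀ x, 0 ≤ g x) (K : ℝ)
    (hK : 0 ≤ K) : X →ᵇ ℝ :=
  BoundedContinuousFunction.ofNormedAddCommGroup (fun x => min (g x) K)
    (hg.min continuous_const) K fun x => by
      rw [Real.norm_of_nonneg (le_min (hg0 x) hK)]
      exact min_le_right _ _

@[simp]
theorem truncate_apply {g : X → ℝ} (hg : Continuous g) (hg0 : ∀ x, 0 ≤ g x) {K : ℝ}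
    (hK : 0 ≤ K) (x : X) : truncate g hg hg0 K hK x = min (g x) K := rfl

variable [MeasurableSpace X] [OpensMeasurableSpace X] {ι : Type*} {F : Filter ι}
  {ρ' : Measure X} {ρ : ι → Measure X}

/-- A bound on the integrals of a nonnegative continuous function passes to weak limits. -/
theorem integrable_and_integral_le_of_tendsto [F.NeBot] [∀ i, IsFiniteMeasure (ρ i)]
    [IsFiniteMeasure ρ']
    (hρ : ∀ f : X →ᵇ ℝ, Tendsto (fun i => ∫ x, f x ∂(ρ i)) F (𝓝 (∫ x, f x ∂ρ')))
    {g : X → ℝ} (hg : Continuous g) (hg0 : ∀ x, 0 ≤ g x) {C : ℝ}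
    (hint : ∀ i, Integrable g (ρ i)) (hC : ∀ i, ∫ x, g x ∂(ρ i) ≤ C) :
    Integrable g ρ' ∧ ∫ x, g x ∂ρ' ≤ C := by
  have hcover : AECover ρ' atTop fun n : ℕ => {x | g x ≤ n} :=
    { ae_eventually_mem := ae_of_all _ fun x => by
        filter_upwards [eventually_ge_atTop ⌈g x⌉₊] with n hn
        exact Nat.ceil_le.mp hn
      measurableSet := fun n => (isClosed_le hg continuous_const).measurableSet }
  have htrunc (n : ℕ) : ∫ x, min (g x) n ∂ρ' ≤ C := by
    refine le_of_tendsto' (hρ (truncate g hg hg0 n n.cast_nonneg)) fun i => ?_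
    exact (integral_mono ((truncate g hg hg0 n n.cast_nonneg).integrable (ρ i)) (hint i)
      fun x => min_le_left _ _).trans (hC i)
  have hon (n : ℕ) : EqOn g (fun x => min (g x) n) {x | g x ≤ n} :=
    fun x hx => (min_eq_left hx).symm
  have hminint (n : ℕ) : Integrable (fun x => min (g x) n) ρ' :=
    (truncate g hg hg0 n n.cast_nonneg).integrable ρ'
  have hset (n : ℕ) : ∫ x in {x | g x ≤ n}, g x ∂ρ' ≤ C := by
    rw [setIntegral_congr_fun (hcover.measurableSet n) (hon n)]
    exact (setIntegral_le_integral (hminint n)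
      (ae_of_all _ fun x => le_min (hg0 x) n.cast_nonneg)).trans (htrunc n)
  have hgint : Integrable g ρ' :=
    hcover.integrable_of_integral_bounded_of_nonneg_ae C
      (fun n => (hminint n).integrableOn.congr_fun (hon n).symm (hcover.measurableSet n))
      (ae_of_all _ hg0) (Eventually.of_forall hset)
  exact ⟨hgint, le_of_tendsto' (hcover.integral_tendsto_of_countably_generated hgint) hset⟩

theorem abs_integral_sub_integral_min_le {κ : Measure X} [IsFiniteMeasure κ] {g : X → ℝ}
    (hg : Continuous g) (hg0 : ∀ x, 0 ≤ g x) {C K : ℝ} (hK : 0 < K) (hint : Integrable g κ)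
    (hint2 : Integrable (fun x => g x ^ 2) κ) (hC : ∫ x, g x ^ 2 ∂κ ≤ C) :
    |∫ x, g x ∂κ - ∫ x, min (g x) K ∂κ| ≤ C / K := by
  have hmin : Integrable (fun x => min (g x) K) κ := (truncate g hg hg0 K hK.le).integrable κ
  rw [← integral_sub hint hmin,
    abs_of_nonneg (integral_nonneg fun x => sub_nonneg.mpr (min_le_left _ _))]
  calc ∫ x, (g x - min (g x) K) ∂κ ≤ ∫ x, g x ^ 2 / K ∂κ := by
        refine integral_mono (hint.sub hmin) (hint2.div_const K) fun x => ?_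
        rw [le_div_iff₀ hK]
        rcases le_total (g x) K with h | h
        · simp [min_eq_left h, sq_nonneg]
        · simp only [min_eq_right h]
          nlinarith [hg0 x]
    _ ≤ C / K := by
        rw [integral_div]
        gcongr

/-- Integrals of a nonnegative continuous function with bounded second moments converge along a
weakly convergent family of measures. -/
theorem tendsto_integral_of_integral_sq_le [∀ i, IsFiniteMeasure (ρ i)]
    [IsFiniteMeasure ρ']
    (hρ : ∀ f : X →ᵇ ℝ, Tendsto (fun i => ∫ x, f x ∂(ρ i)) F (𝓝 (∫ x, f x ∂ρ')))
    {g : X → ℝ} (hg : Continuous g) (hg0 : ∀ x, 0 ≤ g x) {C : ℝ}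
    (hint : ∀ i, Integrable g (ρ i)) (hint' : Integrable g ρ')
    (hint2 : ∀ i, Integrable (fun x => g x ^ 2) (ρ i)) (hC : ∀ i, ∫ x, g x ^ 2 ∂(ρ i) ≤ C) :
    Tendsto (fun i => ∫ x, g x ∂(ρ i)) F (𝓝 (∫ x, g x ∂ρ')) := by
  rcases F.eq_or_neBot with rfl | _
  · exact tendsto_bot
  obtain ⟨h2', hC'⟩ := integrable_and_integral_le_of_tendsto hρ (hg.pow 2)
    (fun x => sq_nonneg (g x)) hint2 hC
  rw [Metric.tendsto_nhds]
  intro ε hε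
  have hlim : Tendsto (fun K : ℝ => C / K) atTop (𝓝 0) := tendsto_const_nhds.div_atTop tendsto_id
  obtain ⟨K, hKε, hK⟩ := ((hlim.eventually_lt_const (show 0 < ε / 3 by positivity)).and
    (eventually_gt_atTop 0)).exists
  filter_upwards [Metric.tendsto_nhds.mp (hρ (truncate g hg hg0 K hK.le)) (ε / 3)
    (by positivity)] with i hi
  have h1 := abs_le.mp (abs_integral_sub_integral_min_le hg hg0 hK (hint i) (hint2 i) (hC i))
  have h2 := abs_le.mp (abs_integral_sub_integral_min_le hg hg0 hK hint' h2' hC')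
  simp only [truncate_apply, Real.dist_eq] at hi ⊢
  rw [abs_lt] at hi ⊢
  constructor <;> linarith [hi.1, hi.2, h1.1, h1.2, h2.1, h2.2]

/-- Probability measures converge weakly as soon as they do so after multiplication by a
positive continuous density. -/
theorem tendsto_integral_of_tendsto_integral_mul [∀ i, IsProbabilityMeasure (ρ i)]
    [IsProbabilityMeasure ρ'] {w : X → ℝ} (hw : Continuous w) (hw0 : ∀ x, 0 < w x)
    (h : ∀ f : X →ᵇ ℝ, Tendsto (fun i => ∫ x, w x * f x ∂(ρ i)) F (𝓝 (∫ x, w x * f x ∂ρ')))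
    (f : X →ᵇ ℝ) : Tendsto (fun i => ∫ x, f x ∂(ρ i)) F (𝓝 (∫ x, f x ∂ρ')) := by
  rcases F.eq_or_neBot with rfl | _
  · exact tendsto_bot
  revert f
  refine tendsto_integral_of_forall_integral_le_liminf_integral fun f hf => ?_
  have hf0 (x : X) : 0 ≤ f x := hf x
  have hq : Continuous fun x => f x / w x := f.continuous.div hw fun x => (hw0 x).ne'
  have hq0 (x : X) : 0 ≤ f x / w x := div_nonneg (hf0 x) (hw0 x).le
  have heq (K : ℝ) (x : X) : w x * min (f x / w x) K = min (f x) (w x * K) := by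
    rw [mul_min_of_nonneg _ _ (hw0 x).le, mul_div_cancel₀ _ (hw0 x).ne']
  have hmin0 (n : ℕ) (x : X) : 0 ≤ min (f x) (w x * n) :=
    le_min (hf0 x) (mul_nonneg (hw0 x).le n.cast_nonneg)
  have hlim : Tendsto (fun n : ℕ => ∫ x, min (f x) (w x * n) ∂ρ') atTop (𝓝 (∫ x, f x ∂ρ')) := by
    refine tendsto_integral_of_dominated_convergence f
      (fun n => (f.continuous.min (hw.mul continuous_const)).aestronglyMeasurable)
      (f.integrable ρ') (fun n => ae_of_all _ fun x => ?_) (ae_of_all _ fun x => ?_)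
    · rw [Real.norm_of_nonneg (hmin0 n x)]
      exact min_le_left _ _
    · refine tendsto_const_nhds.congr' ?_
      filter_upwards [eventually_ge_atTop ⌈f x / w x⌉₊] with n hn
      exact (min_eq_left ((div_le_iff₀' (hw0 x)).mp (Nat.ceil_le.mp hn))).symm
  have hbdd : IsBoundedUnder (· ≤ ·) F fun i => ∫ x, f x ∂(ρ i) :=
    isBoundedUnder_of ⟨‖f‖, fun i => (le_abs_self _).trans (f.norm_integral_le_norm (ρ i))⟩
  refine le_of_tendsto' hlim fun n => ?_
  have hn := h (truncate _ hq hq0 n n.cast_nonneg)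
  simp only [truncate_apply, heq] at hn
  rw [← hn.liminf_eq]
  refine liminf_le_liminf (Eventually.of_forall fun i => ?_) hn.isBoundedUnder_ge
    hbdd.isCoboundedUnder_ge
  exact integral_mono_of_nonneg (ae_of_all _ (hmin0 n)) (f.integrable (ρ i))
    (ae_of_all _ fun x => min_le_left _ _)

end Truncation

/-- **Curtiss' theorem**: convergence of moment generating functions in a neighborhood of `0`
implies weak convergence. -/
theorem tendsto_of_tendsto_integral_exp {ρ : ℕ → ProbabilityMeasure ℝ} {ρ' : ProbabilityMeasure ℝ}
    {δ : ℝ} (hδ : 0 < δ)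
    (hint : ∀ n, ∀ t ∈ Ioo (-δ) δ, Integrable (fun x => Real.exp (t * x)) (ρ n : Measure ℝ))
    (hint' : ∀ t ∈ Ioo (-δ) δ, Integrable (fun x => Real.exp (t * x)) (ρ' : Measure ℝ))
    (h : ∀ t ∈ Ioo (-δ) δ, Tendsto (fun n => ∫ x, Real.exp (t * x) ∂(ρ n : Measure ℝ)) atTop
      (𝓝 (∫ x, Real.exp (t * x) ∂(ρ' : Measure ℝ)))) :
    Tendsto ρ atTop (𝓝 ρ') := by
  have hbdd (t : ℝ) (ht : t ∈ Ioo (-δ) δ) :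
      ∃ C, ∀ n, ∫ x, Real.exp (t * x) ∂(ρ n : Measure ℝ) ≤ C := by
    obtain ⟨C, hC⟩ := (h t ht).bddAbove_range
    exact ⟨C, fun n => hC ⟨n, rfl⟩⟩
  have hmem : δ / 2 ∈ Ioo (-δ) δ := ⟨by linarith, by linarith⟩
  have hmem' : -(δ / 2) ∈ Ioo (-δ) δ := ⟨by linarith, by linarith⟩
  obtain ⟨C, hC⟩ := hbdd _ hmem
  obtain ⟨C', hC'⟩ := hbdd _ hmem'
  have htight : IsTightMeasureSet (range fun n => (ρ n : Measure ℝ)) :=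
    isTightMeasureSet_range_of_integral_exp_le (half_pos hδ) (fun n => hint n _ hmem)
      (fun n => hint n _ hmem') (fun n => (hC n).trans (le_max_left C C'))
      (fun n => (hC' n).trans (le_max_right C C'))
  have hcompact : IsCompact (closure (range ρ)) :=
    isCompact_closure_of_isTightMeasureSet (by simpa [range] using htight)
  refine (tendsto_iff_ultrafilter _ _ _).2 fun U hU => ?_
  obtain ⟨κ, -, hκ : Tendsto ρ U (𝓝 κ)⟩ := hcompact.ultrafilter_le_nhds (U.map ρ)
    (.trans (by simp) (monotone_principal subset_closure))
  suffices (κ : Measure ℝ) = ρ' by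
    rwa [ProbabilityMeasure.toMeasure_injective this] at hκ
  rw [ProbabilityMeasure.tendsto_iff_forall_integral_tendsto] at hκ
  have hκint (t : ℝ) (ht : t ∈ Ioo (-δ) δ) :
      Integrable (fun x => Real.exp (t * x)) (κ : Measure ℝ) := by
    obtain ⟨B, hB⟩ := hbdd t ht
    exact (integrable_and_integral_le_of_tendsto hκ (by fun_prop) (fun x => (Real.exp_pos _).le)
      (fun n => hint n t ht) hB).1
  have hhalf : Ioo (-(δ / 2)) (δ / 2) ⊆ Ioo (-δ) δ :=
    Ioo_subset_Ioo (by linarith) (by linarith)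
  refine Measure.ext_of_eqOn_mgf (half_pos hδ) (fun t ht => hκint t (hhalf ht))
    (fun t ht => hint' t (hhalf ht)) fun t ht => ?_
  have h2t : 2 * t ∈ Ioo (-δ) δ := ⟨by linarith [ht.1], by linarith [ht.2]⟩
  have hsq : (fun x : ℝ => Real.exp (t * x) ^ 2) = fun x => Real.exp (2 * t * x) := by
    funext x
    rw [← Real.exp_nat_mul]
    ring_nf
  obtain ⟨B, hB⟩ := hbdd _ h2t
  refine tendsto_nhds_unique (tendsto_integral_of_integral_sq_le (C := B) hκ (by fun_prop)
    (fun x => (Real.exp_pos _).le) (fun n => hint n t (hhalf ht)) (hκint t (hhalf ht))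
    (fun n => ?_) fun n => ?_) ((h t (hhalf ht)).mono_left hU)
  · rw [hsq]
    exact hint n _ h2t
  · rw [hsq]
    exact hB n

theorem integrable_exp_mul_tilted {κ : Measure ℝ} {c t : ℝ}
    (hc : Integrable (fun x => Real.exp (c * x)) κ)
    (ht : Integrable (fun x => Real.exp ((c + t) * x)) κ) :
    Integrable (fun x => Real.exp (t * x)) (κ.tilted (c * ·)) := by
  rw [integrable_tilted_iff hc]
  simpa only [smul_eq_mul, ← Real.exp_add, ← add_mul] using ht

theorem integral_exp_mul_tilted (κ : Measure ℝ) (c t : ℝ) :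
    ∫ x, Real.exp (t * x) ∂(κ.tilted (c * ·)) =
      (∫ x, Real.exp ((c + t) * x) ∂κ) / ∫ x, Real.exp (c * x) ∂κ := by
  rw [integral_exp_tilted]
  simp only [Pi.add_apply, ← add_mul]

/-- Necessity direction of Theorem 1: if the mgfs, each finite on `(a,b)`, converge on
`(a,b)` to the mgf of a probability measure `ν` (finite on `(a,b)`), then the mgfs are
pointwise bounded on `(a,b)` and the measures converge weakly to `ν`. -/
theorem curtiss_converse_one_sided_necessity
    (μ : ℕ → Measure ℝ) (hprob : ∀ n, IsProbabilityMeasure (μ n))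
    (a b : ℝ) (hab : a < b)
    (hfin : ∀ n, ∀ t ∈ Ioo a b, Integrable (fun x => Real.exp (t * x)) (μ n))
    (ν : Measure ℝ) (hν : IsProbabilityMeasure ν)
    (hνfin : ∀ t ∈ Ioo a b, Integrable (fun x => Real.exp (t * x)) ν)
    (hconv : ∀ t ∈ Ioo a b,
      Tendsto (fun n => ∫ x, Real.exp (t * x) ∂(μ n)) atTop
        (nhds (∫ x, Real.exp (t * x) ∂ν))) :
    (∀ t ∈ Ioo a b,
      BddAbove (Set.range fun n => ∫ x, Real.exp (t * x) ∂(μ n))) ∧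
    (∀ f : ℝ →ᵇ ℝ,
      Tendsto (fun n => ∫ x, f x ∂(μ n)) atTop (nhds (∫ x, f x ∂ν))) := by
  refine ⟨fun t ht => (hconv t ht).bddAbove_range, ?_⟩
  set c := (a + b) / 2 with hc
  have hcmem : c ∈ Ioo a b := ⟨by linarith, by linarith⟩
  have hmem (t : ℝ) (ht : t ∈ Ioo (-((b - a) / 2)) ((b - a) / 2)) : c + t ∈ Ioo a b :=
    ⟨by linarith [ht.1], by linarith [ht.2]⟩
  have hνpos : 0 < ∫ x, Real.exp (c * x) ∂ν := integral_exp_pos (hνfin c hcmem)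
  have hμpos (n : ℕ) : 0 < ∫ x, Real.exp (c * x) ∂(μ n) := integral_exp_pos (hfin n c hcmem)
  let ρ (n : ℕ) : ProbabilityMeasure ℝ :=
    ⟨(μ n).tilted (c * ·), isProbabilityMeasure_tilted (hfin n c hcmem)⟩
  let ρ' : ProbabilityMeasure ℝ := ⟨ν.tilted (c * ·), isProbabilityMeasure_tilted (hνfin c hcmem)⟩
  have hρ : Tendsto ρ atTop (𝓝 ρ') := by
    refine tendsto_of_tendsto_integral_exp (half_pos (sub_pos.mpr hab))
      (fun n t ht => integrable_exp_mul_tilted (hfin n c hcmem) (hfin n _ (hmem t ht)))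
      (fun t ht => integrable_exp_mul_tilted (hνfin c hcmem) (hνfin _ (hmem t ht)))
      fun t ht => ?_
    simp only [ρ, ρ', ProbabilityMeasure.coe_mk, integral_exp_mul_tilted]
    exact (hconv _ (hmem t ht)).div (hconv c hcmem) hνpos.ne'
  rw [ProbabilityMeasure.tendsto_iff_forall_integral_tendsto] at hρ
  refine tendsto_integral_of_tendsto_integral_mul (w := fun x => Real.exp (c * x)) (by fun_prop)
    (fun x => Real.exp_pos _) fun f => ?_
  have huntilt (κ : Measure ℝ) (hκ : 0 < ∫ x, Real.exp (c * x) ∂κ) :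
      (∫ x, Real.exp (c * x) ∂κ) * ∫ x, f x ∂(κ.tilted (c * ·)) =
        ∫ x, Real.exp (c * x) * f x ∂κ := by
    rw [integral_tilted, ← integral_const_mul]
    congr with x
    rw [smul_eq_mul]
    field_simp
  have hlim := (hconv c hcmem).mul (hρ f)
  simp only [ρ, ρ', ProbabilityMeasure.coe_mk, huntilt ν hνpos, huntilt _ (hμpos _)] at hlim
  exact hlim
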